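/- Let β ∈ (0,2], s ≥ −1 and T > 0. Then there exists a constant c = c(T,β,s) > 0 such that for all k, ξ ∈ ℝⁿ and all t ∈ (0,T] one has ω_β(k, ξ−tk)^{2(s+1)} · e_β(t,k,ξ−tk) ≤ c · ω_β(k,ξ)^{2s} / t². -/

import Mathlib

open MeasureTheory Set Filter
open scoped ENNReal

noncomputable section

/-- `ℝⁿ` with the Euclidean norm. -/
abbrev En (n : ℕ) : Type := EuclideanSpace ℝ (Fin n)

/-- `e_β(t,k,ξ) = exp(−∫₀ᵗ ‖ξ + σ k‖^β dσ)`. -/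
def eB (n : ℕ) (β t : ℝ) (k ξ : En n) : ℝ :=
  Real.exp (-(∫ σ in (0:ℝ)..t, ‖ξ + σ • k‖ ^ β))

/-- `ω_β(k,ξ) = 1 + ‖k‖^{β/(β+1)} + ‖ξ‖^β`. -/
def omegaB (n : ℕ) (β : ℝ) (k ξ : En n) : ℝ := 1 + ‖k‖ ^ (β / (β + 1)) + ‖ξ‖ ^ β

theorem norm_rpow_le_four_mul_add {E : Type*} [NormedAddCommGroup E] {β : ℝ}
    (hβ : β ∈ Ioc (0:ℝ) 2) {x a b : E} (h : ‖x‖ ≤ ‖a‖ + ‖b‖) :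
    ‖x‖ ^ β ≤ 4 * (‖a‖ ^ β + ‖b‖ ^ β) := by
  have hm : ‖x‖ ≤ 2 * max ‖a‖ ‖b‖ := by
    linarith [le_max_left ‖a‖ ‖b‖, le_max_right ‖a‖ ‖b‖]
  have h0 : 0 ≤ max ‖a‖ ‖b‖ := le_max_of_le_left (norm_nonneg a)
  have h2 : (2:ℝ) ^ β ≤ 4 := by
    calc (2:ℝ) ^ β ≤ (2:ℝ) ^ (2:ℝ) :=
          Real.rpow_le_rpow_of_exponent_le (by norm_num) hβ.2
      _ = 4 := by norm_num
  have ha : 0 ≤ ‖a‖ ^ β := by positivity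
  have hb : 0 ≤ ‖b‖ ^ β := by positivity
  calc ‖x‖ ^ β ≤ (2 * max ‖a‖ ‖b‖) ^ β :=
        Real.rpow_le_rpow (norm_nonneg x) hm hβ.1.le
    _ = 2 ^ β * max ‖a‖ ‖b‖ ^ β := Real.mul_rpow (by norm_num) h0
    _ ≤ 4 * max ‖a‖ ‖b‖ ^ β := by gcongr
    _ ≤ 4 * (‖a‖ ^ β + ‖b‖ ^ β) := by
        rcases max_choice ‖a‖ ‖b‖ with h | h <;> rw [h] <;> linarith

theorem continuous_norm_add_smul_rpow {E : Type*} [NormedAddCommGroup E] [NormedSpace ℝ E]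
    {β : ℝ} (hβ : 0 ≤ β) (η k : E) : Continuous fun σ : ℝ => ‖η + σ • k‖ ^ β :=
  Continuous.rpow_const (by fun_prop) fun _ => Or.inr hβ

/-- Pairing `σ` with `σ + t / 2` bounds the integral below, whatever the base point `η`. -/
theorem rpow_mul_norm_rpow_le_integral {E : Type*} [NormedAddCommGroup E] [NormedSpace ℝ E]
    {β t : ℝ} (hβ : β ∈ Ioc (0:ℝ) 2) (ht : 0 < t) (η k : E) :
    t * (t ^ β * ‖k‖ ^ β) ≤ 64 * ∫ σ in (0:ℝ)..t, ‖η + σ • k‖ ^ β := by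
  have hc := continuous_norm_add_smul_rpow hβ.1.le η k
  have hc' : Continuous fun σ : ℝ => ‖η + (σ + t / 2) • k‖ ^ β :=
    hc.comp (continuous_add_const (t / 2))
  have hsplit : ∫ σ in (0:ℝ)..t, ‖η + σ • k‖ ^ β =
      ∫ σ in (0:ℝ)..(t / 2), (‖η + σ • k‖ ^ β + ‖η + (σ + t / 2) • k‖ ^ β) := by
    rw [intervalIntegral.integral_add (hc.intervalIntegrable _ _) (hc'.intervalIntegrable _ _),
      intervalIntegral.integral_comp_add_right (fun σ : ℝ => ‖η + σ • k‖ ^ β) (t / 2),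
      zero_add, add_halves,
      intervalIntegral.integral_add_adjacent_intervals (hc.intervalIntegrable _ _)
        (hc.intervalIntegrable _ _)]
  have hpt : ∀ σ : ℝ, t ^ β * ‖k‖ ^ β / 32 ≤
      ‖η + σ • k‖ ^ β + ‖η + (σ + t / 2) • k‖ ^ β := by
    intro σ
    have h1 := norm_rpow_le_four_mul_add hβ (x := (t / 2) • k) (a := η + (σ + t / 2) • k)
      (b := η + σ • k) (by
        have : (t / 2) • k = (η + (σ + t / 2) • k) - (η + σ • k) := by module
        rw [this]; exact norm_sub_le _ _)
    have h2 := norm_rpow_le_four_mul_add hβ (x := t • k) (a := (t / 2) • k) (b := (t / 2) • k) (by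
        have : t • k = (t / 2) • k + (t / 2) • k := by module
        rw [this]; exact norm_add_le _ _)
    rw [norm_smul t k, Real.norm_of_nonneg ht.le, Real.mul_rpow ht.le (norm_nonneg k)] at h2
    linarith
  have hmono : ∫ _ in (0:ℝ)..(t / 2), t ^ β * ‖k‖ ^ β / 32 ≤
      ∫ σ in (0:ℝ)..(t / 2), (‖η + σ • k‖ ^ β + ‖η + (σ + t / 2) • k‖ ^ β) := by
    exact intervalIntegral.integral_mono_on (by positivity) (by simp)
      ((hc.add hc').intervalIntegrable _ _) fun σ _ => hpt σ
  rw [intervalIntegral.integral_const, smul_eq_mul, ← hsplit] at hmono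
  linarith

theorem mul_norm_rpow_le_integral {E : Type*} [NormedAddCommGroup E] [NormedSpace ℝ E]
    {β t : ℝ} (hβ : β ∈ Ioc (0:ℝ) 2) (ht : 0 < t) (η k : E) :
    t * ‖η‖ ^ β ≤ 260 * ∫ σ in (0:ℝ)..t, ‖η + σ • k‖ ^ β := by
  have hc := continuous_norm_add_smul_rpow hβ.1.le η k
  have hmono : ∫ _ in (0:ℝ)..t, (‖η‖ ^ β / 4 - t ^ β * ‖k‖ ^ β) ≤
      ∫ σ in (0:ℝ)..t, ‖η + σ • k‖ ^ β := by
    refine intervalIntegral.integral_mono_on ht.le (by simp) (hc.intervalIntegrable _ _)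
      fun σ hσ => ?_
    have h1 := norm_rpow_le_four_mul_add hβ (x := η) (a := η + σ • k) (b := t • k) (by
      have h2 : ‖η‖ ≤ ‖η + σ • k‖ + ‖σ • k‖ := by
        simpa using norm_sub_le (η + σ • k) (σ • k)
      have h3 : ‖σ • k‖ ≤ ‖t • k‖ := by
        rw [norm_smul, norm_smul, Real.norm_of_nonneg hσ.1, Real.norm_of_nonneg ht.le]
        exact mul_le_mul_of_nonneg_right hσ.2 (norm_nonneg k)
      linarith)
    rw [norm_smul, Real.norm_of_nonneg ht.le, Real.mul_rpow ht.le (norm_nonneg k)] at h1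
    linarith
  rw [intervalIntegral.integral_const, smul_eq_mul] at hmono
  linarith [rpow_mul_norm_rpow_le_integral hβ ht η k]

theorem rpow_le_one_add {x p : ℝ} (hx : 0 ≤ x) (hp0 : 0 ≤ p) (hp1 : p ≤ 1) : x ^ p ≤ 1 + x := by
  calc x ^ p ≤ (1 + x) ^ p := Real.rpow_le_rpow hx (by linarith) hp0
    _ ≤ (1 + x) ^ (1:ℝ) := Real.rpow_le_rpow_of_exponent_le (by linarith) hp1
    _ = 1 + x := Real.rpow_one _

theorem mul_rpow_div_le {β t r : ℝ} (hβ : 0 < β) (ht : 0 < t) (hr : 0 ≤ r) :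
    t * r ^ (β / (β + 1)) ≤ 1 + t * (t ^ β * r ^ β) := by
  have hβ1 : 0 < β + 1 := by linarith
  calc t * r ^ (β / (β + 1)) = (t * (t ^ β * r ^ β)) ^ (1 / (β + 1)) := by
        rw [← mul_assoc, ← Real.rpow_one_add' ht.le (by linarith),
          Real.mul_rpow (by positivity) (by positivity), ← Real.rpow_mul ht.le,
          ← Real.rpow_mul hr, mul_one_div, mul_one_div, add_comm 1 β, div_self hβ1.ne',
          Real.rpow_one]
    _ ≤ _ := rpow_le_one_add (by positivity) (by positivity)
        ((div_le_one hβ1).2 (by linarith))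

theorem rpow_mul_rpow_le {β t r : ℝ} (hβ : 0 < β) (ht : 0 < t) (hr : 0 ≤ r) :
    t ^ β * r ^ β ≤ (1 + t * (t ^ β * r ^ β)) * r ^ (β / (β + 1)) := by
  have hβ1 : 0 < β + 1 := by linarith
  calc t ^ β * r ^ β = (t * (t ^ β * r ^ β)) ^ (β / (β + 1)) * r ^ (β / (β + 1)) := by
        rw [← mul_assoc, ← Real.rpow_one_add' ht.le (by linarith),
          Real.mul_rpow (by positivity) (by positivity), ← Real.rpow_mul ht.le,
          ← Real.rpow_mul hr, mul_assoc, ← Real.rpow_add_of_nonneg hr (by positivity)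
          (by positivity)]
        congr 2
        · field_simp
          ring
        · field_simp
    _ ≤ _ := by
        gcongr
        exact rpow_le_one_add (by positivity) (by positivity)
          ((div_le_one hβ1).2 (by linarith))

theorem one_le_omegaB (n : ℕ) (β : ℝ) (k ξ : En n) : 1 ≤ omegaB n β k ξ := by
  have h1 : 0 ≤ ‖k‖ ^ (β / (β + 1)) := by positivity
  have h2 : 0 ≤ ‖ξ‖ ^ β := by positivity
  unfold omegaB
  linarith

theorem omegaB_le_mul_omegaB {n : ℕ} {β t I : ℝ} (hβ : β ∈ Ioc (0:ℝ) 2) (ht : 0 < t)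
    (k : En n) {ξ η : En n} (hI : t * (t ^ β * ‖k‖ ^ β) ≤ 64 * I)
    (h : ‖η‖ ≤ ‖ξ‖ + ‖t • k‖) :
    omegaB n β k η ≤ 261 * (1 + I) * omegaB n β k ξ := by
  have hI0 : 0 ≤ I := by
    have : 0 ≤ t * (t ^ β * ‖k‖ ^ β) := by positivity
    linarith
  have h1 := norm_rpow_le_four_mul_add hβ h
  rw [norm_smul, Real.norm_of_nonneg ht.le, Real.mul_rpow ht.le (norm_nonneg k)] at h1
  have h2 := rpow_mul_rpow_le hβ.1 ht (norm_nonneg k)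
  have hK : 0 ≤ ‖k‖ ^ (β / (β + 1)) := by positivity
  have hX : 0 ≤ ‖ξ‖ ^ β := by positivity
  have h3 : t ^ β * ‖k‖ ^ β ≤ (1 + 64 * I) * ‖k‖ ^ (β / (β + 1)) :=
    h2.trans (by gcongr)
  unfold omegaB
  nlinarith [mul_nonneg hI0 hK, mul_nonneg hI0 hX]

theorem mul_omegaB_le {n : ℕ} {β t T : ℝ} (hβ : β ∈ Ioc (0:ℝ) 2) (ht : t ∈ Ioc (0:ℝ) T)
    (k η : En n) :
    t * omegaB n β k η ≤ (T + 325) * (1 + ∫ σ in (0:ℝ)..t, ‖η + σ • k‖ ^ β) := by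
  have h1 := rpow_mul_norm_rpow_le_integral hβ ht.1 η k
  have h2 := mul_norm_rpow_le_integral hβ ht.1 η k
  have h3 := mul_rpow_div_le hβ.1 ht.1 (norm_nonneg k)
  have h4 : 0 ≤ t * (t ^ β * ‖k‖ ^ β) := mul_nonneg ht.1.le (by have := ht.1; positivity)
  have hT : 0 ≤ T := ht.1.le.trans ht.2
  set I := ∫ σ in (0:ℝ)..t, ‖η + σ • k‖ ^ β
  have hI : 0 ≤ I := by linarith
  unfold omegaB
  nlinarith [ht.2, mul_nonneg hT hI]

theorem rpow_le_rpow_mul_exp {x p : ℝ} (hx : 0 ≤ x) (hp : 0 < p) :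
    x ^ p ≤ p ^ p * Real.exp x := by
  have h : x ≤ p * Real.exp (x / p) := by
    have h1 := Real.add_one_le_exp (x / p)
    calc x = p * (x / p) := by field_simp
      _ ≤ p * Real.exp (x / p) := by gcongr; linarith
  calc x ^ p ≤ (p * Real.exp (x / p)) ^ p := Real.rpow_le_rpow hx h hp.le
    _ = p ^ p * Real.exp x := by
      rw [Real.mul_rpow hp.le (Real.exp_pos _).le, ← Real.exp_mul, div_mul_cancel₀ _ hp.ne']

theorem rpow_mul_rpow_neg_le {a b M : ℝ} (ha : 0 < a) (hb : 0 < b)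
    (hab : a ≤ M * b) (hba : b ≤ M * a) (q : ℝ) : a ^ q * b ^ (-q) ≤ M ^ |q| := by
  rcases le_total 0 q with hq | hq
  · rw [abs_of_nonneg hq, Real.rpow_neg hb.le, ← div_eq_mul_inv, ← Real.div_rpow ha.le hb.le]
    exact Real.rpow_le_rpow (by positivity) ((div_le_iff₀ hb).2 hab) hq
  · have ha' : a ^ q = (a ^ (-q))⁻¹ := by rw [Real.rpow_neg ha.le, inv_inv]
    rw [abs_of_nonpos hq, ha', mul_comm, ← div_eq_mul_inv, ← Real.div_rpow hb.le ha.le]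
    exact Real.rpow_le_rpow (by positivity) ((div_le_iff₀ ha).2 hba) (by linarith)

theorem stmt1 (n : ℕ) (hn : 1 ≤ n) (β s T : ℝ) (hβ : β ∈ Ioc (0:ℝ) 2)
    (hs : (-1:ℝ) ≤ s) (hT : 0 < T) :
    ∃ c : ℝ, 0 < c ∧ ∀ k ξ : En n, ∀ t ∈ Ioc (0:ℝ) T,
      omegaB n β k (ξ - t • k) ^ (2 * (s + 1)) * eB n β t k (ξ - t • k)
        ≤ c * omegaB n β k ξ ^ (2 * s) / t ^ 2 := by
  have hp : 0 < 2 + |2 * s| := by positivity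
  refine ⟨(T + 325) ^ 2 * 261 ^ |2 * s| * ((2 + |2 * s|) ^ (2 + |2 * s|) * Real.exp 1),
    by positivity, fun k ξ t ht => ?_⟩
  have ht0 := ht.1
  have h1 := mul_omegaB_le hβ ht k (ξ - t • k)
  have hI := rpow_mul_norm_rpow_le_integral hβ ht0 (ξ - t • k) k
  unfold eB
  set I := ∫ σ in (0:ℝ)..t, ‖ξ - t • k + σ • k‖ ^ β
  have hI0 : 0 ≤ I := by
    have : 0 ≤ t * (t ^ β * ‖k‖ ^ β) := by positivity
    linarith
  have hab := omegaB_le_mul_omegaB hβ ht0 k hI (norm_sub_le ξ (t • k))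
  have hba := omegaB_le_mul_omegaB hβ ht0 k hI (ξ := ξ - t • k) (η := ξ)
    (by simpa using norm_add_le (ξ - t • k) (t • k))
  have hA := one_le_omegaB n β k (ξ - t • k)
  have hB := one_le_omegaB n β k ξ
  set A := omegaB n β k (ξ - t • k)
  set B := omegaB n β k ξ
  have hA0 : 0 < A := by linarith
  have hB0 : 0 < B := by linarith
  have hJ : 0 < 1 + I := by linarith
  have h2 := rpow_mul_rpow_neg_le hA0 hB0 hab hba (2 * s)
  have h3 := rpow_le_rpow_mul_exp hJ.le hp
  have h4 : (t * A) ^ 2 ≤ ((T + 325) * (1 + I)) ^ 2 := pow_le_pow_left₀ (by positivity) h1 2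
  have hBs : B ^ (2 * s) * B ^ (-(2 * s)) = 1 := by
    rw [← Real.rpow_add hB0, add_neg_cancel, Real.rpow_zero]
  have hAs : A ^ (2 * (s + 1)) = A ^ 2 * A ^ (2 * s) := by
    rw [mul_add, mul_one, add_comm, Real.rpow_add hA0, Real.rpow_two]
  rw [le_div_iff₀ (by positivity)]
  calc A ^ (2 * (s + 1)) * Real.exp (-I) * t ^ 2
      = (t * A) ^ 2 * (A ^ (2 * s) * B ^ (-(2 * s))) * Real.exp (-I) * B ^ (2 * s) := by
        rw [hAs]
        linear_combination (-(t * A) ^ 2 * A ^ (2 * s) * Real.exp (-I)) * hBs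
    _ ≤ ((T + 325) * (1 + I)) ^ 2 * (261 * (1 + I)) ^ |2 * s| * Real.exp (-I)
          * B ^ (2 * s) := by gcongr
    _ = (T + 325) ^ 2 * 261 ^ |2 * s| * ((1 + I) ^ (2 + |2 * s|) * Real.exp (-I))
          * B ^ (2 * s) := by
        rw [Real.mul_rpow (by norm_num) hJ.le, Real.rpow_add hJ, Real.rpow_two]
        ring
    _ ≤ (T + 325) ^ 2 * 261 ^ |2 * s| *
          (((2 + |2 * s|) ^ (2 + |2 * s|) * Real.exp (1 + I)) * Real.exp (-I))
          * B ^ (2 * s) := by gcongr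
    _ = _ := by
        rw [mul_assoc ((2 + |2 * s|) ^ (2 + |2 * s|)), ← Real.exp_add, add_neg_cancel_right]
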